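/- There exist δ > 0 with r₋ − δ > 0 and functions Ĥ_in, Ĥ_out : 𝒰 × (r₋ − δ, r₊) → ℂ such that: (i) for every ω ∈ 𝒰, the maps r ↦ Ĥ_in(ω,r) and r ↦ Ĥ_out(ω,r) are real-analytic on (r₋ − δ, r₊) and satisfy Ĥ_in(ω, r₋) = Ĥ_out(ω, r₋) = 1; (ii) for every fixed r, the maps ω ↦ Ĥ_in(ω,r) and ω ↦ Ĥ_out(ω,r) are holomorphic on 𝒰; (iii) for every ω ∈ 𝒰, the functions R_in(ω,r) := (r − r₋)^(−iω/(2κ₋))·Ĥ_in(ω,r) and R_out(ω,r) := (r − r₋)^(iω/(2κ₋))·Ĥ_out(ω,r) solve the radial o.d.e. with frequency ω on the interval (r₋, r₊). -/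

import Mathlib

noncomputable section

/-- The metric coefficient `μ(r) = 1 - 2M/r + e²/r² - (Λ/3)r²`. -/
def mu (M e Λ : ℝ) (r : ℝ) : ℝ := 1 - 2*M/r + e^2/r^2 - (Λ/3)*r^2

/-- Surface gravity of the event horizon: `κ₊ = (1/2)·μ′(r₊)`. -/
def kappaP (M e Λ rp : ℝ) : ℝ := (1/2) * deriv (mu M e Λ) rp

/-- Surface gravity of the Cauchy horizon: `κ₋ = -(1/2)·μ′(r₋)`. -/
def kappaM (M e Λ rm : ℝ) : ℝ := -(1/2) * deriv (mu M e Λ) rm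

/-- Surface gravity of the cosmological horizon: `κ_c = -(1/2)·μ′(r_c)`. -/
def kappaC (M e Λ rc : ℝ) : ℝ := -(1/2) * deriv (mu M e Λ) rc

/-- A twice-differentiable `R : I → ℂ` solves the radial o.d.e. with frequency `ω`:
`r⁻²·μ(r)·(d/dr)(r²·μ(r)·R′(r)) + ω²·R(r) = 0` for all `r ∈ I`. -/
def SolvesODE (M e Λ : ℝ) (ω : ℂ) (I : Set ℝ) (R : ℝ → ℂ) : Prop :=
  (∀ r ∈ I, DifferentiableAt ℝ R r) ∧
  (∀ r ∈ I, DifferentiableAt ℝ (deriv R) r) ∧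
  ∀ r ∈ I, ((r:ℂ)^2)⁻¹ * (mu M e Λ r : ℂ) *
      deriv (fun s : ℝ => (s:ℂ)^2 * (mu M e Λ s : ℂ) * deriv R s) r
    + ω^2 * R r = 0

/-- The set `𝒰` of `ω ∈ ℂ` not of the form `i·κ·n` with `κ ∈ {κ₊, κ₋, κ_c}` and
`n` a nonzero integer. -/
def calU (kp km kc : ℝ) : Set ℂ :=
  {ω : ℂ | ∀ κ ∈ ({kp, km, kc} : Set ℝ), ∀ n : ℤ, n ≠ 0 → ω ≠ Complex.I * κ * n}

/-- Taylor coefficients of the solution `f` with `f 0 = 1` of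
`(θ² + 2sθ) f + a (θ + s) f - s² g f = 0`, where `θ = z * d/dz` and `A`, `G` are the Taylor
coefficients of `a`, `g`, both vanishing at the origin. -/
def frobeniusCoeff (A G : ℕ → ℂ) (s : ℂ) : ℕ → ℂ
  | 0 => 1
  | n + 1 => -(∑ k : Fin (n + 1),
      (A (n + 1 - k) * (k + s) - s ^ 2 * G (n + 1 - k)) * frobeniusCoeff A G s k) /
        ((n + 1 : ℕ) * ((n + 1 : ℕ) + 2 * s))

theorem frobeniusCoeff_rec (A G : ℕ → ℂ) {s : ℂ} (hs : ∀ n : ℕ, n ≠ 0 → (n + 2 * s : ℂ) ≠ 0)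
    (n : ℕ) :
    (n * (n + 2 * s) : ℂ) * frobeniusCoeff A G s n = -∑ k ∈ Finset.range n,
      (A (n - k) * (k + s) - s ^ 2 * G (n - k)) * frobeniusCoeff A G s k := by
  cases n with
  | zero => simp
  | succ n =>
    have h1 := hs (n + 1) (by omega)
    have h2 : ((n + 1 : ℕ) : ℂ) ≠ 0 := by exact_mod_cast Nat.succ_ne_zero n
    rw [frobeniusCoeff, mul_div_cancel₀ _ (mul_ne_zero h2 h1), ← Fin.sum_univ_eq_sum_range
      (fun k => (A (n + 1 - k) * (k + s) - s ^ 2 * G (n + 1 - k)) * frobeniusCoeff A G s k)]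

theorem differentiableOn_frobeniusCoeff (A G : ℕ → ℂ) {U : Set ℂ}
    (hU : ∀ s ∈ U, ∀ n : ℕ, n ≠ 0 → (n + 2 * s : ℂ) ≠ 0) (n : ℕ) :
    DifferentiableOn ℂ (fun s => frobeniusCoeff A G s n) U := by
  induction n using Nat.strong_induction_on with
  | _ n ih =>
    cases n with
    | zero => simp only [frobeniusCoeff]; fun_prop
    | succ n =>
      simp only [frobeniusCoeff]
      refine DifferentiableOn.div (DifferentiableOn.neg (DifferentiableOn.fun_sum fun k _ => ?_))
        (by fun_prop) fun s hs => ?_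
      · exact DifferentiableOn.mul (by fun_prop) (ih k k.2)
      · exact mul_ne_zero (by exact_mod_cast Nat.succ_ne_zero n) (hU s hs _ (by omega))

theorem le_succ_pow_of_mul_le_sum {b : ℕ → ℝ} {K : ℕ} (h0 : b 0 ≤ 1) (hb : ∀ n, 0 ≤ b n)
    (h : ∀ n : ℕ, n ≠ 0 → n * b n ≤ K * ∑ k ∈ Finset.range n, b k) (n : ℕ) :
    b n ≤ ((n : ℝ) + 1) ^ K := by
  have key : ∀ n : ℕ, ∑ k ∈ Finset.range (n + 1), b k ≤ ((n : ℝ) + 1) ^ K := by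
    intro n
    induction n with
    | zero => simpa using h0
    | succ n ih =>
      rw [Finset.sum_range_succ]
      have h1 := h (n + 1) (by omega)
      set S := ∑ k ∈ Finset.range (n + 1), b k
      have hpos : (0 : ℝ) < n + 1 := by positivity
      push_cast at h1 ⊢
      have h2 : b (n + 1) ≤ S * (K * (1 / (n + 1))) := by
        rw [mul_one_div, mul_div_assoc', le_div_iff₀ hpos]; linarith
      have h3 : 1 + (K : ℝ) * (1 / (n + 1)) ≤ (1 + 1 / ((n : ℝ) + 1)) ^ K :=
        one_add_mul_le_pow (by have : 0 < 1 / ((n : ℝ) + 1) := by positivity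
                               linarith) K
      have hS : 0 ≤ S := Finset.sum_nonneg fun k _ => hb k
      calc S + b (n + 1) ≤ S * (1 + K * (1 / (n + 1))) := by linarith
        _ ≤ ((n : ℝ) + 1) ^ K * (1 + 1 / ((n : ℝ) + 1)) ^ K := by gcongr
        _ = ((n : ℝ) + 1 + 1) ^ K := by
          rw [← mul_pow]; congr 1; field_simp
  refine le_trans ?_ (key n)
  exact Finset.single_le_sum (f := b) (fun k _ => hb k) (Finset.self_mem_range_succ n)

theorem exists_mul_le_norm_add {s₀ : ℂ} (hs : ∀ n : ℕ, n ≠ 0 → (n + 2 * s₀ : ℂ) ≠ 0) :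
    ∃ c > 0, ∀ s ∈ Metric.ball s₀ c, ∀ n : ℕ, n ≠ 0 → c * n ≤ ‖(n + 2 * s : ℂ)‖ := by
  have h1 : ∀ N : ℕ, ∃ c : ℝ, 0 < c ∧ ∀ n < N, n ≠ 0 → c * n ≤ ‖(n + 2 * s₀ : ℂ)‖ := by
    intro N
    induction N with
    | zero => exact ⟨1, one_pos, by simp⟩
    | succ N ih =>
      obtain ⟨c, hc, h⟩ := ih
      by_cases hN : N = 0
      · exact ⟨c, hc, fun n hn h0 => by omega⟩
      have hN' : (0 : ℝ) < N := by positivity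
      refine ⟨min c (‖(N + 2 * s₀ : ℂ)‖ / N), lt_min hc
        (div_pos (norm_pos_iff.2 (hs N hN)) hN'), fun n hn h0 => ?_⟩
      rcases Nat.lt_succ_iff_lt_or_eq.1 hn with h' | rfl
      · exact le_trans (by gcongr; exact min_le_left _ _) (h n h' h0)
      · calc _ ≤ (‖(n + 2 * s₀ : ℂ)‖ / n) * n := by gcongr; exact min_le_right _ _
          _ = _ := by field_simp
  obtain ⟨N, hN⟩ := exists_nat_gt (4 * ‖s₀‖)
  obtain ⟨c, hc, h⟩ := h1 N
  refine ⟨min c (1 / 2) / 3, by positivity, fun s hs n hn => ?_⟩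
  set d := min c (1 / 2)
  have hd : 0 < d := by positivity
  have hn1 : (1 : ℝ) ≤ n := by exact_mod_cast Nat.one_le_iff_ne_zero.2 hn
  have h2 : d * n ≤ ‖(n + 2 * s₀ : ℂ)‖ := by
    rcases lt_or_ge n N with h' | h'
    · exact le_trans (by gcongr; exact min_le_left _ _) (h n h' hn)
    · have h3 : (N : ℝ) ≤ n := by exact_mod_cast h'
      have h4 := norm_sub_le (n + 2 * s₀ : ℂ) (2 * s₀)
      simp only [add_sub_cancel_right, norm_mul, Complex.norm_natCast, Complex.norm_ofNat] at h4
      have h5 : d * n ≤ 1 / 2 * n := by gcongr; exact min_le_right _ _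
      linarith
  have h3 := norm_sub_le (n + 2 * s : ℂ) (2 * (s - s₀))
  rw [show (n + 2 * s - 2 * (s - s₀) : ℂ) = n + 2 * s₀ by ring, norm_mul, Complex.norm_ofNat] at h3
  have h4 : ‖s - s₀‖ < d / 3 := by simpa [dist_eq_norm] using hs
  have h5 : d / 3 ≤ d / 3 * n := le_mul_of_one_le_right (by positivity) hn1
  linarith

theorem norm_frobeniusCoeff_mul_pow_le {A G : ℕ → ℂ} {c t C S : ℝ} (hc : 0 < c) (ht : 0 ≤ t)
    (hA : ∀ n, ‖A n‖ * t ^ n ≤ C) (hG : ∀ n, ‖G n‖ * t ^ n ≤ C) {s : ℂ} (hS : ‖s‖ ≤ S)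
    (hs : ∀ n : ℕ, n ≠ 0 → c * n ≤ ‖(n + 2 * s : ℂ)‖) {K : ℕ}
    (hK : C * (1 + S + S ^ 2) / c ≤ K) (n : ℕ) :
    ‖frobeniusCoeff A G s n‖ * t ^ n ≤ ((n : ℝ) + 1) ^ K := by
  have hne : ∀ n : ℕ, n ≠ 0 → (n + 2 * s : ℂ) ≠ 0 := fun n hn => by
    have : 0 < c * n := by positivity
    exact norm_pos_iff.1 (this.trans_le (hs n hn))
  have hC : 0 ≤ C := le_trans (by positivity) (hA 0)
  have hS0 : 0 ≤ S := le_trans (norm_nonneg _) hS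
  refine le_succ_pow_of_mul_le_sum (b := fun n => ‖frobeniusCoeff A G s n‖ * t ^ n)
    (by simp [frobeniusCoeff]) (fun n => by positivity) (fun n hn => ?_) n
  have hn0 : (0 : ℝ) < n := by positivity
  have hn1 : (1 : ℝ) ≤ n := by exact_mod_cast Nat.one_le_iff_ne_zero.2 hn
  have hrec := congrArg norm (frobeniusCoeff_rec A G hne n)
  rw [norm_neg, norm_mul, norm_mul, Complex.norm_natCast] at hrec
  set a := frobeniusCoeff A G s
  set T := ∑ k ∈ Finset.range n, ‖a k‖ * t ^ k with hT
  have hT0 : 0 ≤ T := Finset.sum_nonneg fun k _ => by positivity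
  have hterm : ∀ k ∈ Finset.range n,
      ‖(A (n - k) * (k + s) - s ^ 2 * G (n - k)) * a k‖ * t ^ n ≤
        C * (1 + S + S ^ 2) * n * (‖a k‖ * t ^ k) := by
    intro k hk
    have hkn : k < n := Finset.mem_range.1 hk
    have hkn' : (k : ℝ) ≤ n := by exact_mod_cast hkn.le
    have e1 : t ^ n = t ^ (n - k) * t ^ k := by rw [← pow_add]; congr 1; omega
    have e2 : ‖A (n - k) * (k + s) - s ^ 2 * G (n - k)‖ ≤
        ‖A (n - k)‖ * (n + S) + S ^ 2 * ‖G (n - k)‖ := by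
      refine (norm_sub_le _ _).trans ?_
      rw [norm_mul, norm_mul, norm_pow]
      gcongr
      refine (norm_add_le _ _).trans ?_
      rw [Complex.norm_natCast]
      gcongr
    rw [norm_mul, e1]
    calc _ = (‖A (n - k) * (k + s) - s ^ 2 * G (n - k)‖ * t ^ (n - k)) * (‖a k‖ * t ^ k) := by ring
      _ ≤ ((‖A (n - k)‖ * (n + S) + S ^ 2 * ‖G (n - k)‖) * t ^ (n - k)) * (‖a k‖ * t ^ k) := by
        gcongr
      _ = ((‖A (n - k)‖ * t ^ (n - k)) * (n + S) + S ^ 2 * (‖G (n - k)‖ * t ^ (n - k))) *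
          (‖a k‖ * t ^ k) := by ring
      _ ≤ (C * (n + S) + S ^ 2 * C) * (‖a k‖ * t ^ k) := by
        gcongr
        · exact hA _
        · exact hG _
      _ ≤ (C * (n + S * n) + S ^ 2 * n * C) * (‖a k‖ * t ^ k) := by
        gcongr
        · exact le_mul_of_one_le_right hS0 hn1
        · exact le_mul_of_one_le_right (sq_nonneg S) hn1
      _ = _ := by ring
  have h1 : (n * (c * n)) * (‖a n‖ * t ^ n) ≤ C * (1 + S + S ^ 2) * n * T := by
    calc _ ≤ (n * ‖(n + 2 * s : ℂ)‖) * (‖a n‖ * t ^ n) := by gcongr; exact hs n hn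
      _ = (n * ‖(n + 2 * s : ℂ)‖ * ‖a n‖) * t ^ n := by ring
      _ ≤ (∑ k ∈ Finset.range n, ‖(A (n - k) * (k + s) - s ^ 2 * G (n - k)) * a k‖) * t ^ n := by
        rw [hrec]; gcongr; exact norm_sum_le _ _
      _ ≤ _ := by rw [Finset.sum_mul, hT, Finset.mul_sum]; exact Finset.sum_le_sum hterm
  calc n * (‖a n‖ * t ^ n) = (n * (c * n)) * (‖a n‖ * t ^ n) / (c * n) := by field_simp
    _ ≤ C * (1 + S + S ^ 2) * n * T / (c * n) := by gcongr
    _ = C * (1 + S + S ^ 2) / c * T := by field_simp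
    _ ≤ K * T := by gcongr

theorem summable_norm_mul_pow_of_le {a : ℕ → ℂ} {t y C : ℝ} {K : ℕ} (hy : 0 ≤ y) (hyt : y < t)
    (h : ∀ n, ‖a n‖ * t ^ n ≤ C * ((n : ℝ) + 1) ^ K) :
    Summable (fun n : ℕ => C * ((n : ℝ) + 1) ^ K * (y / t) ^ n) ∧
      ∀ n, ‖a n‖ * y ^ n ≤ C * ((n : ℝ) + 1) ^ K * (y / t) ^ n := by
  have ht : 0 < t := hy.trans_lt hyt
  have hq : 0 ≤ y / t := by positivity
  have hq1 : y / t < 1 := (div_lt_one ht).2 hyt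
  constructor
  · simp only [mul_assoc]
    refine Summable.mul_left C ?_
    have h1 := summable_norm_mul_geometric_of_norm_lt_one (k := K) (r := y / t)
      (u := fun n => (n + 1) ^ K) (by rwa [Real.norm_of_nonneg hq]) (by
        push_cast
        refine Asymptotics.IsBigO.pow (Asymptotics.IsBigO.add (Asymptotics.isBigO_refl _ _) ?_) K
        refine Asymptotics.IsBigO.of_bound 1 ((Filter.eventually_ge_atTop 1).mono fun n hn => ?_)
        simpa using hn)
    refine h1.of_norm.congr fun n => ?_
    push_cast
    rfl
  · intro n
    calc ‖a n‖ * y ^ n = ‖a n‖ * t ^ n * (y / t) ^ n := by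
          rw [div_pow]; field_simp
      _ ≤ _ := by exact mul_le_mul_of_nonneg_right (h n) (by positivity)

theorem summable_norm_natCast_mul {a : ℕ → ℂ} {ρ : ℝ}
    (ha : ∀ y, 0 ≤ y → y < ρ → Summable fun n => ‖a n‖ * y ^ n) {y : ℝ} (hy : 0 ≤ y) (hyρ : y < ρ) :
    Summable fun n : ℕ => ‖(n : ℂ) * a n‖ * y ^ n := by
  obtain ⟨t, hyt, htρ⟩ := exists_between hyρ
  have ht : 0 ≤ t := hy.trans hyt.le
  have h1 := ha t ht htρ
  have h2 : ∀ n, ‖a n‖ * t ^ n ≤ ∑' n, ‖a n‖ * t ^ n := fun n =>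
    h1.le_tsum n fun k _ => by positivity
  obtain ⟨h3, h4⟩ := summable_norm_mul_pow_of_le (a := fun n : ℕ => (n : ℂ) * a n) (K := 1)
    (C := ∑' n, ‖a n‖ * t ^ n) hy hyt fun n => by
      rw [norm_mul, Complex.norm_natCast, mul_assoc, mul_comm, pow_one]
      exact mul_le_mul (h2 n) (by linarith) (by positivity) (tsum_nonneg fun k => by positivity)
  exact Summable.of_nonneg_of_le (fun n => by positivity) h4 h3

theorem norm_mul_pow_le_of_mem_ball (a : ℕ → ℂ) {t : ℝ} (n : ℕ) {w : ℂ}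
    (hw : w ∈ Metric.ball (0 : ℂ) t) : ‖a n * w ^ n‖ ≤ ‖a n‖ * t ^ n := by
  have : ‖w‖ ≤ t := by simpa using (Metric.mem_ball.1 hw).le
  rw [norm_mul, norm_pow]
  gcongr

theorem differentiableOn_tsum_mul_pow {a : ℕ → ℂ} {ρ : ℝ}
    (ha : ∀ y, 0 ≤ y → y < ρ → Summable fun n => ‖a n‖ * y ^ n) :
    DifferentiableOn ℂ (fun z => ∑' n, a n * z ^ n) (Metric.ball 0 ρ) := by
  intro z hz
  obtain ⟨t, hzt, htρ⟩ := exists_between (by simpa using hz : ‖z‖ < ρ)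
  have hz' : z ∈ Metric.ball (0 : ℂ) t := by simpa using hzt
  refine DifferentiableAt.differentiableWithinAt ?_
  exact (Complex.differentiableOn_tsum_of_summable_norm (ha t ((norm_nonneg z).trans hzt.le) htρ)
    (fun n => by fun_prop) Metric.isOpen_ball
    (fun n w hw => norm_mul_pow_le_of_mem_ball a n hw)).differentiableAt
    (Metric.isOpen_ball.mem_nhds hz')

theorem mul_deriv_tsum_mul_pow {a : ℕ → ℂ} {ρ : ℝ}
    (ha : ∀ y, 0 ≤ y → y < ρ → Summable fun n => ‖a n‖ * y ^ n) {z : ℂ}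
    (hz : z ∈ Metric.ball 0 ρ) :
    z * deriv (fun z => ∑' n, a n * z ^ n) z = ∑' n : ℕ, (n * a n) * z ^ n := by
  obtain ⟨t, hzt, htρ⟩ := exists_between (by simpa using hz : ‖z‖ < ρ)
  have hz' : z ∈ Metric.ball (0 : ℂ) t := by simpa using hzt
  have h := (Complex.hasSum_deriv_of_summable_norm (F := fun n w => a n * w ^ n)
    (ha t ((norm_nonneg z).trans hzt.le) htρ)
    (fun n => by fun_prop) Metric.isOpen_ball
    (fun n w hw => norm_mul_pow_le_of_mem_ball a n hw) hz').mul_left z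
  rw [← h.tsum_eq]
  refine tsum_congr fun n => ?_
  cases n with
  | zero => simp
  | succ n => simp; ring

theorem summable_norm_mul_norm_pow {a : ℕ → ℂ} {ρ : ℝ}
    (ha : ∀ y, 0 ≤ y → y < ρ → Summable fun n => ‖a n‖ * y ^ n) {z : ℂ}
    (hz : z ∈ Metric.ball 0 ρ) : Summable fun n => ‖a n * z ^ n‖ := by
  simpa using ha ‖z‖ (norm_nonneg z) (by simpa using hz)

theorem exists_hasSum_pow_of_differentiableOn_ball {f : ℂ → ℂ} {ρ : ℝ}
    (hf : DifferentiableOn ℂ f (Metric.ball 0 ρ)) :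
    ∃ a : ℕ → ℂ, a 0 = f 0 ∧ (∀ z ∈ Metric.ball 0 ρ, HasSum (fun n => a n * z ^ n) (f z)) ∧
      ∀ y, 0 ≤ y → y < ρ → Summable fun n => ‖a n‖ * y ^ n := by
  set a : ℕ → ℂ := fun n => (n.factorial : ℂ)⁻¹ * iteratedDeriv n f 0 with ha
  have hsum : ∀ z ∈ Metric.ball 0 ρ, HasSum (fun n => a n * z ^ n) (f z) := by
    intro z hz
    have h := Complex.hasSum_taylorSeries_on_ball hf hz
    refine h.congr_fun fun n => ?_
    simp [ha]; ring
  refine ⟨a, by simp [ha], hsum, fun y hy hyρ => ?_⟩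
  obtain ⟨t, hyt, htρ⟩ := exists_between hyρ
  have ht : 0 < t := hy.trans_lt hyt
  have h0 := (hsum t (by simpa [abs_of_pos ht] using htρ)).summable.norm
  have hb : ∀ n, ‖a n‖ * t ^ n ≤ ∑' n, ‖a n * (t : ℂ) ^ n‖ := fun n => by
    refine le_trans (le_of_eq ?_) (h0.le_tsum n fun k _ => by positivity)
    simp [abs_of_pos ht]
  obtain ⟨h3, h4⟩ := summable_norm_mul_pow_of_le (a := a) (K := 0) hy hyt (by simpa using hb)
  exact Summable.of_nonneg_of_le (fun n => by positivity) h4 h3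

/-- The Frobenius solution of a Fuchsian equation converges on the disc where the coefficients are
holomorphic, and depends holomorphically on the exponent `s` away from resonances. -/
theorem exists_frobenius_solution {A G : ℂ → ℂ} {ρ : ℝ}
    (hA : DifferentiableOn ℂ A (Metric.ball 0 ρ)) (hG : DifferentiableOn ℂ G (Metric.ball 0 ρ))
    (hA0 : A 0 = 0) (hG0 : G 0 = 0) :
    ∃ F : ℂ → ℂ → ℂ,
      (∀ s : ℂ, (∀ n : ℕ, n ≠ 0 → (n + 2 * s : ℂ) ≠ 0) →
        DifferentiableOn ℂ (F s) (Metric.ball 0 ρ) ∧ F s 0 = 1 ∧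
        DifferentiableOn ℂ (fun z => z * deriv (F s) z) (Metric.ball 0 ρ) ∧
        ∀ z ∈ Metric.ball 0 ρ,
          z * deriv (fun w => w * deriv (F s) w) z + 2 * s * (z * deriv (F s) z) +
            A z * (z * deriv (F s) z + s * F s z) - s ^ 2 * G z * F s z = 0) ∧
      ∀ z ∈ Metric.ball 0 ρ, ∀ s : ℂ, (∀ n : ℕ, n ≠ 0 → (n + 2 * s : ℂ) ≠ 0) →
        DifferentiableAt ℂ (fun s => F s z) s := by
  obtain ⟨α, hα0, hαs, hα⟩ := exists_hasSum_pow_of_differentiableOn_ball hA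
  obtain ⟨γ, hγ0, hγs, hγ⟩ := exists_hasSum_pow_of_differentiableOn_ball hG
  rw [hA0] at hα0
  rw [hG0] at hγ0
  have hbound : ∀ s₀ : ℂ, (∀ n : ℕ, n ≠ 0 → (n + 2 * s₀ : ℂ) ≠ 0) → ∃ ε > 0,
      (∀ s ∈ Metric.ball s₀ ε, ∀ n : ℕ, n ≠ 0 → (n + 2 * s : ℂ) ≠ 0) ∧
      ∀ y, 0 ≤ y → y < ρ → ∃ u : ℕ → ℝ, Summable u ∧
        ∀ s ∈ Metric.ball s₀ ε, ∀ n, ‖frobeniusCoeff α γ s n‖ * y ^ n ≤ u n := by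
    intro s₀ hs₀
    obtain ⟨c, hc, hcs⟩ := exists_mul_le_norm_add hs₀
    refine ⟨c, hc, fun s hs n hn => ?_, fun y hy hyρ => ?_⟩
    · have : 0 < c * n := by positivity
      exact norm_pos_iff.1 (this.trans_le (hcs s hs n hn))
    · obtain ⟨t, hyt, htρ⟩ := exists_between hyρ
      have ht : 0 ≤ t := hy.trans hyt.le
      set Cα := ∑' n, ‖α n‖ * t ^ n
      set Cγ := ∑' n, ‖γ n‖ * t ^ n
      have h1 : ∀ n, ‖α n‖ * t ^ n ≤ max Cα Cγ := fun n =>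
        ((hα t ht htρ).le_tsum n fun k _ => by positivity).trans (le_max_left _ _)
      have h2 : ∀ n, ‖γ n‖ * t ^ n ≤ max Cα Cγ := fun n =>
        ((hγ t ht htρ).le_tsum n fun k _ => by positivity).trans (le_max_right _ _)
      obtain ⟨K, hK⟩ := exists_nat_ge (max Cα Cγ * (1 + (‖s₀‖ + c) + (‖s₀‖ + c) ^ 2) / c)
      have h3 : ∀ s ∈ Metric.ball s₀ c, ∀ n,
          ‖frobeniusCoeff α γ s n‖ * t ^ n ≤ 1 * ((n : ℝ) + 1) ^ K := fun s hs n => by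
        rw [one_mul]
        refine norm_frobeniusCoeff_mul_pow_le hc ht h1 h2 ?_ (hcs s hs) hK n
        have h4 : ‖s - s₀‖ < c := by simpa [dist_eq_norm] using hs
        have h5 := norm_add_le s₀ (s - s₀)
        rw [add_sub_cancel] at h5
        linarith
      exact ⟨_, (summable_norm_mul_pow_of_le hy hyt (h3 s₀ (Metric.mem_ball_self hc))).1,
        fun s hs => (summable_norm_mul_pow_of_le hy hyt (h3 s hs)).2⟩
  refine ⟨fun s z => ∑' n, frobeniusCoeff α γ s n * z ^ n, fun s hs => ?_, fun z hz s hs => ?_⟩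
  · beta_reduce
    set a := frobeniusCoeff α γ s with ha_def
    have ha : ∀ y, 0 ≤ y → y < ρ → Summable fun n => ‖a n‖ * y ^ n := by
      obtain ⟨ε, hε, -, h⟩ := hbound s hs
      intro y hy hyρ
      obtain ⟨u, hu, hu'⟩ := h y hy hyρ
      exact Summable.of_nonneg_of_le (fun n => by positivity) (hu' s (Metric.mem_ball_self hε)) hu
    have ha1 : ∀ y, 0 ≤ y → y < ρ → Summable fun n : ℕ => ‖n * a n‖ * y ^ n :=
      fun y => summable_norm_natCast_mul ha
    have ha2 : ∀ y, 0 ≤ y → y < ρ → Summable fun n : ℕ => ‖n * (n * a n)‖ * y ^ n :=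
      fun y => summable_norm_natCast_mul ha1
    have hd1 : ∀ z ∈ Metric.ball 0 ρ, z * deriv (fun z => ∑' n, a n * z ^ n) z =
        ∑' n : ℕ, (n * a n) * z ^ n := fun z => mul_deriv_tsum_mul_pow ha
    refine ⟨differentiableOn_tsum_mul_pow ha, ?_,
      (differentiableOn_tsum_mul_pow ha1).congr hd1, fun z hz => ?_⟩
    · rw [tsum_eq_single 0 (fun n hn => by simp [hn])]
      simp [ha_def, frobeniusCoeff]
    have hd2 : z * deriv (fun w => w * deriv (fun z => ∑' n, a n * z ^ n) w) z =
        ∑' n : ℕ, (n * (n * a n)) * z ^ n := by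
      rw [← mul_deriv_tsum_mul_pow ha1 hz]
      congr 1
      refine Filter.EventuallyEq.deriv_eq ?_
      filter_upwards [Metric.isOpen_ball.mem_nhds hz] with w hw using hd1 w hw
    rw [hd2, hd1 z hz]
    have S0 := summable_norm_mul_norm_pow ha hz
    have S1 := summable_norm_mul_norm_pow ha1 hz
    have S2 := summable_norm_mul_norm_pow ha2 hz
    have Sα := summable_norm_mul_norm_pow hα hz
    have Sγ := summable_norm_mul_norm_pow hγ hz
    have Ss : Summable fun n : ℕ => ‖((n + s) * a n) * z ^ n‖ := by
      refine Summable.of_nonneg_of_le (fun n => norm_nonneg _) (fun n => ?_)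
        (S1.add (S0.mul_left ‖s‖))
      rw [← norm_mul, show ((n + s) * a n) * z ^ n = n * a n * z ^ n + s * (a n * z ^ n) by ring]
      exact norm_add_le _ _
    have e1 : ∑' n : ℕ, (n * a n) * z ^ n + s * ∑' n, a n * z ^ n =
        ∑' n : ℕ, ((n + s) * a n) * z ^ n := by
      rw [← tsum_mul_left, ← S1.of_norm.tsum_add (S0.of_norm.mul_left s)]
      exact tsum_congr fun n => by ring
    rw [e1, ← (hαs z hz).tsum_eq, ← (hγs z hz).tsum_eq, mul_assoc (s ^ 2),
      tsum_mul_tsum_eq_tsum_sum_antidiagonal_of_summable_norm Sα Ss,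
      tsum_mul_tsum_eq_tsum_sum_antidiagonal_of_summable_norm Sγ S0, ← tsum_mul_left,
      ← tsum_mul_left, ← S2.of_norm.tsum_add (S1.of_norm.mul_left _)]
    have T1 := (summable_norm_sum_mul_antidiagonal_of_summable_norm Sα Ss).of_norm
    have T2 := (summable_norm_sum_mul_antidiagonal_of_summable_norm Sγ S0).of_norm.mul_left (s ^ 2)
    have T0 := S2.of_norm.add (S1.of_norm.mul_left (2 * s))
    rw [← T0.tsum_add T1, ← (T0.add T1).tsum_sub T2]
    refine (tsum_congr fun n => ?_).trans tsum_zero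
    have hrec := frobeniusCoeff_rec α γ hs n
    rw [← ha_def] at hrec
    have e2 : ∑ k ∈ Finset.range n, (α (n - k) * (k + s) - s ^ 2 * γ (n - k)) * a k =
        ∑ k ∈ Finset.range (n + 1), (α (n - k) * (k + s) - s ^ 2 * γ (n - k)) * a k := by
      rw [Finset.sum_range_succ, Nat.sub_self, hα0, hγ0]; ring
    rw [e2] at hrec
    rw [Finset.Nat.sum_antidiagonal_eq_sum_range_succ
        (fun i j : ℕ => α i * z ^ i * (((j : ℂ) + s) * a j * z ^ j)),
      Finset.Nat.sum_antidiagonal_eq_sum_range_succ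
        (fun i j : ℕ => γ i * z ^ i * (a j * z ^ j)),
      ← Finset.sum_range_reflect, ← Finset.sum_range_reflect (n := n + 1)
        (f := fun k => γ k * z ^ k * (a (n - k) * z ^ (n - k))), Finset.mul_sum, add_sub_assoc,
      ← Finset.sum_sub_distrib]
    have e3 : (∑ k ∈ Finset.range (n + 1), (α (n - k) * (k + s) - s ^ 2 * γ (n - k)) * a k) * z ^ n
        = ∑ j ∈ Finset.range (n + 1), (α (n + 1 - 1 - j) * z ^ (n + 1 - 1 - j) *
          ((((n - (n + 1 - 1 - j) : ℕ) : ℂ) + s) * a (n - (n + 1 - 1 - j)) *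
            z ^ (n - (n + 1 - 1 - j))) - s ^ 2 * (γ (n + 1 - 1 - j) * z ^ (n + 1 - 1 - j) *
            (a (n - (n + 1 - 1 - j)) * z ^ (n - (n + 1 - 1 - j))))) := by
      rw [Finset.sum_mul]
      refine Finset.sum_congr rfl fun k hk => ?_
      have hk' : k ≤ n := Nat.lt_succ_iff.1 (Finset.mem_range.1 hk)
      have e4 : n - (n + 1 - 1 - k) = k := by omega
      have e5 : z ^ n = z ^ (n - k) * z ^ k := by rw [← pow_add]; congr 1; omega
      rw [e4, e5, Nat.add_sub_cancel]
      ring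
    rw [← e3]
    linear_combination z ^ n * hrec
  · obtain ⟨ε, hε, hne, h⟩ := hbound s hs
    obtain ⟨u, hu, hu'⟩ := h ‖z‖ (norm_nonneg z) (by simpa using hz)
    refine (Complex.differentiableOn_tsum_of_summable_norm hu (fun n => ?_) Metric.isOpen_ball
      (fun n w hw => ?_)).differentiableAt (Metric.ball_mem_nhds s hε)
    · exact (differentiableOn_frobeniusCoeff α γ hne n).mul_const _
    · simpa using hu' w hw n

theorem HasDerivAt.comp_ofReal_sub {f : ℂ → ℂ} {f' : ℂ} {r a : ℝ}
    (hf : HasDerivAt f f' ((r - a : ℝ) : ℂ)) :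
    HasDerivAt (fun y : ℝ => f ((y - a : ℝ) : ℂ)) f' r :=
  HasDerivAt.comp_sub_const r a hf.comp_ofReal

theorem hasDerivAt_cpow_const_of_pos (s : ℂ) {x : ℝ} (hx : 0 < x) :
    HasDerivAt (fun z : ℂ => z ^ s) (s * (x : ℂ) ^ (s - 1)) x := by
  simpa using (hasDerivAt_id (x : ℂ)).cpow_const (c := s) (Or.inl (by simpa using hx))

/-- `(r - a) ^ s * F (r - a)` solves the radial o.d.e. when `F` solves the corresponding
Fuchsian equation, written with the Euler operator `z * d/dz`. -/
theorem solvesODE_cpow_mul {M e Λ a b : ℝ} {ω s : ℂ} {q F : ℂ → ℂ} (ha : 0 < a)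
    (hq : Differentiable ℂ q)
    (hmu : ∀ r : ℝ, r ≠ 0 → (r : ℂ) ^ 2 * (mu M e Λ r : ℂ) = ((r - a : ℝ) : ℂ) * q (r - a : ℝ))
    (hF : DifferentiableOn ℂ F (Metric.ball 0 (b - a)))
    (hF1 : DifferentiableOn ℂ (fun z => z * deriv F z) (Metric.ball 0 (b - a)))
    (hode : ∀ z ∈ Metric.ball 0 (b - a),
      q z * (q z * (z * deriv (fun w => w * deriv F w) z + 2 * s * (z * deriv F z) + s ^ 2 * F z) +
        z * deriv q z * (z * deriv F z + s * F z)) + ω ^ 2 * (z + a) ^ 4 * F z = 0) :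
    SolvesODE M e Λ ω (Set.Ioo a b)
      (fun r => ((r - a : ℝ) : ℂ) ^ s * F ((r - a : ℝ) : ℂ)) := by
  have hball : ∀ r ∈ Set.Ioo a b, ((r - a : ℝ) : ℂ) ∈ Metric.ball (0 : ℂ) (b - a) := by
    rintro r ⟨h1, h2⟩
    rw [mem_ball_zero_iff, Complex.norm_real, Real.norm_of_nonneg (by linarith)]
    linarith
  have hpos : ∀ r ∈ Set.Ioo a b, 0 < r - a := fun r hr => sub_pos.2 hr.1
  have hX : ∀ r ∈ Set.Ioo a b, ((r - a : ℝ) : ℂ) ≠ 0 := fun r hr =>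
    Complex.ofReal_ne_zero.2 (hpos r hr).ne'
  have hcpow : ∀ r ∈ Set.Ioo a b,
      ((r - a : ℝ) : ℂ) ^ s = ((r - a : ℝ) : ℂ) ^ (s - 1) * ((r - a : ℝ) : ℂ) := fun r hr => by
    rw [Complex.cpow_sub _ _ (hX r hr), Complex.cpow_one, div_mul_cancel₀ _ (hX r hr)]
  have hFd : ∀ r ∈ Set.Ioo a b, HasDerivAt F (deriv F (r - a : ℝ)) (r - a : ℝ) := fun r hr =>
    (hF.differentiableAt (Metric.isOpen_ball.mem_nhds (hball r hr))).hasDerivAt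
  have hF1d : ∀ r ∈ Set.Ioo a b, HasDerivAt (fun z => z * deriv F z)
      (deriv (fun z => z * deriv F z) (r - a : ℝ)) (r - a : ℝ) := fun r hr =>
    (hF1.differentiableAt (Metric.isOpen_ball.mem_nhds (hball r hr))).hasDerivAt
  have hR : ∀ r ∈ Set.Ioo a b, HasDerivAt (fun r : ℝ => ((r - a : ℝ) : ℂ) ^ s * F (r - a : ℝ))
      (((r - a : ℝ) : ℂ) ^ (s - 1) *
        (s * F (r - a : ℝ) + (r - a : ℝ) * deriv F (r - a : ℝ))) r := by
    intro r hr
    refine ((hasDerivAt_cpow_const_of_pos s (hpos r hr)).mul (hFd r hr)).comp_ofReal_sub.congr_deriv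
      ?_
    rw [hcpow r hr]
    ring
  have hRev : ∀ r ∈ Set.Ioo a b, deriv (fun r : ℝ => ((r - a : ℝ) : ℂ) ^ s * F (r - a : ℝ)) =ᶠ[nhds r]
      fun r => ((r - a : ℝ) : ℂ) ^ (s - 1) *
        (s * F (r - a : ℝ) + (r - a : ℝ) * deriv F (r - a : ℝ)) := fun r hr => by
    filter_upwards [isOpen_Ioo.mem_nhds hr] with y hy using (hR y hy).deriv
  refine ⟨fun r hr => (hR r hr).differentiableAt, fun r hr => ?_, fun r hr => ?_⟩
  · refine DifferentiableAt.congr_of_eventuallyEq ?_ (hRev r hr)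
    exact ((hasDerivAt_cpow_const_of_pos (s - 1) (hpos r hr)).mul
      (((hFd r hr).const_mul s).add (hF1d r hr))).comp_ofReal_sub.differentiableAt
  · have hev : (fun y : ℝ => (y : ℂ) ^ 2 * (mu M e Λ y : ℂ) *
        deriv (fun r : ℝ => ((r - a : ℝ) : ℂ) ^ s * F (r - a : ℝ)) y) =ᶠ[nhds r]
        fun y => ((y - a : ℝ) : ℂ) ^ s * (q (y - a : ℝ) *
          (s * F (y - a : ℝ) + (y - a : ℝ) * deriv F (y - a : ℝ))) := by
      filter_upwards [hRev r hr, isOpen_Ioo.mem_nhds hr] with y hy hy'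
      rw [hy, hmu y (ha.trans hy'.1).ne', hcpow y hy']
      ring
    have hD := ((hasDerivAt_cpow_const_of_pos s (hpos r hr)).mul
      ((hq _).hasDerivAt.mul (((hFd r hr).const_mul s).add (hF1d r hr)))).comp_ofReal_sub
    rw [hev.deriv_eq]
    erw [hD.deriv]
    have hr0 : (r : ℂ) ≠ 0 := Complex.ofReal_ne_zero.2 (ha.trans hr.1).ne'
    have h1 := hmu r (ha.trans hr.1).ne'
    have h2 := hode _ (hball r hr)
    have h3 : (mu M e Λ r : ℂ) = ((r - a : ℝ) : ℂ) * q (r - a : ℝ) / (r : ℂ) ^ 2 := by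
      rw [← h1]; field_simp
    have h4 : (((r - a : ℝ) : ℂ) + a) = r := by push_cast; ring
    rw [h4] at h2
    rw [h3]
    simp only [Pi.add_apply, Pi.mul_apply, hcpow r hr]
    set X := ((r - a : ℝ) : ℂ)
    field_simp
    linear_combination X ^ (s - 1) * X * h2

theorem sq_mul_mu_eq {M e Λ a b c : ℝ} (ha : 0 < a) (hab : a < b) (hbc : b < c)
    (hza : mu M e Λ a = 0) (hzb : mu M e Λ b = 0) (hzc : mu M e Λ c = 0) {r : ℝ} (hr : r ≠ 0) :
    r ^ 2 * mu M e Λ r = (r - a) * (-(Λ / 3) * (r + a + b + c) * (r - b) * (r - c)) := by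
  have hp : ∀ x : ℝ, x ≠ 0 → x ^ 2 * mu M e Λ x =
      x ^ 2 - 2 * M * x + e ^ 2 - Λ / 3 * x ^ 4 := fun x hx => by
    unfold mu; field_simp
  have hb : 0 < b := ha.trans hab
  have pa := hp a ha.ne'
  have pb := hp b hb.ne'
  have pc := hp c (hb.trans hbc).ne'
  rw [hza, mul_zero] at pa
  rw [hzb, mul_zero] at pb
  rw [hzc, mul_zero] at pc
  have d1 : (a + b) - 2 * M - Λ / 3 * ((a + b) * (a ^ 2 + b ^ 2)) = 0 := by
    apply mul_left_cancel₀ (sub_ne_zero.2 hab.ne)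
    linear_combination pb - pa
  have d2 : (b + c) - 2 * M - Λ / 3 * ((b + c) * (b ^ 2 + c ^ 2)) = 0 := by
    apply mul_left_cancel₀ (sub_ne_zero.2 hbc.ne)
    linear_combination pc - pb
  have d3 : 1 - Λ / 3 * (a ^ 2 + b ^ 2 + c ^ 2 + a * b + b * c + c * a) = 0 := by
    apply mul_left_cancel₀ (sub_ne_zero.2 (hab.trans hbc).ne)
    linear_combination d1 - d2
  rw [hp r hr]
  linear_combination (r - a) * (r - b) * d3 + (r - a) * d1 - pa

theorem deriv_mu_eq {M e Λ a b c : ℝ} (ha : 0 < a) (hab : a < b) (hbc : b < c)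
    (hza : mu M e Λ a = 0) (hzb : mu M e Λ b = 0) (hzc : mu M e Λ c = 0) :
    deriv (mu M e Λ) a = -(Λ / 3) * (2 * a + b + c) * (a - b) * (a - c) / a ^ 2 := by
  have hev : mu M e Λ =ᶠ[nhds a]
      fun r => (r - a) * (-(Λ / 3) * (r + a + b + c) * (r - b) * (r - c) / r ^ 2) := by
    filter_upwards [isOpen_ne.mem_nhds ha.ne'] with r hr
    rw [← mul_div_assoc, ← sq_mul_mu_eq ha hab hbc hza hzb hzc hr]
    have : r ≠ 0 := hr
    field_simp
  have hg : DifferentiableAt ℝ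
      (fun r : ℝ => -(Λ / 3) * (r + a + b + c) * (r - b) * (r - c) / r ^ 2) a :=
    DifferentiableAt.div (by fun_prop) (by fun_prop) (pow_ne_zero 2 ha.ne')
  have h := ((hasDerivAt_id a).sub_const a).mul hg.hasDerivAt
  rw [hev.deriv_eq]
  erw [h.deriv]
  simp
  ring

theorem analyticOnNhd_comp_ofReal_sub {F : ℂ → ℂ} {a ρ : ℝ}
    (hF : DifferentiableOn ℂ F (Metric.ball 0 ρ)) {I : Set ℝ}
    (hI : ∀ r ∈ I, ((r - a : ℝ) : ℂ) ∈ Metric.ball (0 : ℂ) ρ) :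
    AnalyticOnNhd ℝ (fun r : ℝ => F ((r - a : ℝ) : ℂ)) I := by
  intro r hr
  have h1 : AnalyticAt ℝ F ((r - a : ℝ) : ℂ) :=
    (hF.analyticAt (Metric.isOpen_ball.mem_nhds (hI r hr))).restrictScalars
  have h2 : AnalyticAt ℝ (fun r : ℝ => ((r - a : ℝ) : ℂ)) r :=
    (Complex.ofRealCLM.analyticAt _).comp (analyticAt_id.sub analyticAt_const)
  exact AnalyticAt.fun_comp h1 h2

theorem natCast_add_ne_zero_of_mem_calU {kp km kc : ℝ} (hk : km ≠ 0) {ω : ℂ}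
    (hω : ω ∈ calU kp km kc) {n : ℕ} (hn : n ≠ 0) :
    (n + 2 * (-(Complex.I * ω) / (2 * (km : ℂ))) : ℂ) ≠ 0 ∧
      (n + 2 * (Complex.I * ω / (2 * (km : ℂ))) : ℂ) ≠ 0 := by
  have hk' : (km : ℂ) ≠ 0 := Complex.ofReal_ne_zero.2 hk
  constructor <;> intro h <;> field_simp at h
  · refine hω km (by simp) (-n) (by simpa using hn) ?_
    push_cast
    linear_combination Complex.I * h + ω * Complex.I_sq
  · refine hω km (by simp) n (by simpa using hn) ?_
    push_cast
    linear_combination -Complex.I * h + ω * Complex.I_sq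

/-- Existence of the basis solutions `R_in,−`, `R_out,−` near `r = r₋`:
there is `δ > 0` with `r₋ − δ > 0` and `Ĥ_{in/out}(ω,·)` real-analytic on
`(r₋ − δ, r₊)`, equal to `1` at `r₋`, holomorphic in `ω` on `𝒰`, such that
`R_{in/out}(ω,r) = (r − r₋)^(∓iω/(2κ₋))·Ĥ_{in/out}(ω,r)` solve the radial o.d.e.
with frequency `ω` on `(r₋, r₊)`. -/
theorem basis_solutions_cauchy_horizon (M e Λ rm rp rc : ℝ)
    (hM : 0 < M) (he : 0 < e) (hΛ : 0 < Λ)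
    (h₀ : 0 < rm) (h₁ : rm < rp) (h₂ : rp < rc)
    (hzm : mu M e Λ rm = 0) (hzp : mu M e Λ rp = 0) (hzc : mu M e Λ rc = 0) :
    ∃ δ : ℝ, 0 < δ ∧ 0 < rm - δ ∧ ∃ Hin Hout : ℂ → ℝ → ℂ,
      (∀ ω ∈ calU (kappaP M e Λ rp) (kappaM M e Λ rm) (kappaC M e Λ rc),
        AnalyticOnNhd ℝ (Hin ω) (Set.Ioo (rm - δ) rp) ∧
        AnalyticOnNhd ℝ (Hout ω) (Set.Ioo (rm - δ) rp) ∧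
        Hin ω rm = 1 ∧ Hout ω rm = 1) ∧
      (∀ r ∈ Set.Ioo (rm - δ) rp,
        DifferentiableOn ℂ (fun ω => Hin ω r)
          (calU (kappaP M e Λ rp) (kappaM M e Λ rm) (kappaC M e Λ rc)) ∧
        DifferentiableOn ℂ (fun ω => Hout ω r)
          (calU (kappaP M e Λ rp) (kappaM M e Λ rm) (kappaC M e Λ rc))) ∧
      (∀ ω ∈ calU (kappaP M e Λ rp) (kappaM M e Λ rm) (kappaC M e Λ rc),
        SolvesODE M e Λ ω (Set.Ioo rm rp)
          (fun r => ((r - rm : ℝ) : ℂ) ^ (-(Complex.I * ω) / (2 * (kappaM M e Λ rm : ℂ))) * Hin ω r) ∧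
        SolvesODE M e Λ ω (Set.Ioo rm rp)
          (fun r => ((r - rm : ℝ) : ℂ) ^ ((Complex.I * ω) / (2 * (kappaM M e Λ rm : ℂ))) * Hout ω r)) := by
  set κ := kappaM M e Λ rm with hκ
  have hrp : 0 < rp := h₀.trans h₁
  have hρ : 0 < rp - rm := sub_pos.2 h₁
  have hκ' : κ = Λ / 6 * (2 * rm + rp + rc) * (rp - rm) * (rc - rm) / rm ^ 2 := by
    rw [hκ, kappaM, deriv_mu_eq h₀ h₁ h₂ hzm hzp hzc]
    ring
  have hκ0 : 0 < κ := by
    rw [hκ']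
    have h3 : 0 < rc - rm := by linarith
    have h4 : 0 < 2 * rm + rp + rc := by linarith
    positivity
  set q : ℂ → ℂ := fun z => -((Λ : ℂ) / 3) * (z + (2 * rm + rp + rc : ℝ)) *
    (z - (rp - rm : ℝ)) * (z - (rc - rm : ℝ)) with hq_def
  have hq : Differentiable ℂ q := by fun_prop
  have hq0 : q 0 = -2 * κ * rm ^ 2 := by
    have : (rm : ℂ) ≠ 0 := Complex.ofReal_ne_zero.2 h₀.ne'
    rw [hq_def, hκ']
    push_cast
    field_simp
    ring
  have hmu : ∀ r : ℝ, r ≠ 0 →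
      (r : ℂ) ^ 2 * (mu M e Λ r : ℂ) = ((r - rm : ℝ) : ℂ) * q (r - rm : ℝ) := fun r hr => by
    have := congrArg (Complex.ofReal) (sq_mul_mu_eq h₀ h₁ h₂ hzm hzp hzc hr)
    push_cast at this
    rw [this, hq_def]
    push_cast
    ring
  have hqne : ∀ z ∈ Metric.ball (0 : ℂ) (rp - rm), q z ≠ 0 := by
    intro z hz
    have hz' : ‖z‖ < rp - rm := by simpa using hz
    have key : ∀ x : ℝ, rp - rm ≤ |x| → z - (x : ℂ) ≠ 0 := fun x hx h => by
      rw [sub_eq_zero] at h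
      rw [h, Complex.norm_real, Real.norm_eq_abs] at hz'
      linarith
    refine mul_ne_zero (mul_ne_zero (mul_ne_zero ?_ ?_) (key _ (le_abs_self _)))
      (key _ ((by linarith : rp - rm ≤ rc - rm).trans (le_abs_self _)))
    · exact neg_ne_zero.2 (div_ne_zero (Complex.ofReal_ne_zero.2 hΛ.ne') (by norm_num))
    · have := key (-(2 * rm + rp + rc)) (by rw [abs_neg, abs_of_pos] <;> linarith)
      rwa [Complex.ofReal_neg, sub_neg_eq_add] at this
  obtain ⟨F, hF, hFs⟩ := exists_frobenius_solution (ρ := rp - rm)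
    (A := fun z => z * deriv q z / q z)
    (G := fun z => 4 * κ ^ 2 * (z + rm) ^ 4 / q z ^ 2 - 1)
    (DifferentiableOn.div (differentiableOn_id.mul
      (hq.differentiableOn.deriv isOpen_univ |>.mono (Set.subset_univ _)))
      hq.differentiableOn hqne)
    (DifferentiableOn.sub_const (DifferentiableOn.div (by fun_prop) (by fun_prop)
      fun z hz => pow_ne_zero 2 (hqne z hz)) _)
    (by simp) (by
      have h1 : (rm : ℂ) ≠ 0 := Complex.ofReal_ne_zero.2 h₀.ne'
      have h2 : (κ : ℂ) ≠ 0 := Complex.ofReal_ne_zero.2 hκ0.ne'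
      simp only [hq0]
      field_simp
      ring)
  have hsol : ∀ ω s : ℂ, (∀ n : ℕ, n ≠ 0 → (n + 2 * s : ℂ) ≠ 0) → ω ^ 2 = -(4 * κ ^ 2 * s ^ 2) →
      SolvesODE M e Λ ω (Set.Ioo rm rp)
        (fun r => ((r - rm : ℝ) : ℂ) ^ s * F s ((r - rm : ℝ) : ℂ)) := by
    intro ω s hs hω
    obtain ⟨hd, -, hd1, hode⟩ := hF s hs
    refine solvesODE_cpow_mul h₀ hq hmu hd hd1 fun z hz => ?_
    have h := hode z hz
    have hqz := hqne z hz
    rw [hω]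
    field_simp at h
    linear_combination h
  set δ := min (rm / 2) (rp - rm)
  have hball : ∀ r ∈ Set.Ioo (rm - δ) rp, ((r - rm : ℝ) : ℂ) ∈ Metric.ball (0 : ℂ) (rp - rm) := by
    rintro r ⟨h3, h4⟩
    have h5 : δ ≤ rp - rm := min_le_right _ _
    rw [mem_ball_zero_iff, Complex.norm_real, Real.norm_eq_abs, abs_lt]
    constructor <;> linarith
  have hκc : (κ : ℂ) ≠ 0 := Complex.ofReal_ne_zero.2 hκ0.ne'
  refine ⟨δ, by positivity, by have : δ ≤ rm / 2 := min_le_left _ _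
                               linarith,
    fun ω r => F (-(Complex.I * ω) / (2 * (κ : ℂ))) ((r - rm : ℝ) : ℂ),
    fun ω r => F (Complex.I * ω / (2 * (κ : ℂ))) ((r - rm : ℝ) : ℂ), fun ω hω => ?_,
    fun r hr => ?_, fun ω hω => ?_⟩
  · have hin := hF _ fun n hn => (natCast_add_ne_zero_of_mem_calU hκ0.ne' hω hn).1
    have hout := hF _ fun n hn => (natCast_add_ne_zero_of_mem_calU hκ0.ne' hω hn).2
    exact ⟨analyticOnNhd_comp_ofReal_sub hin.1 hball, analyticOnNhd_comp_ofReal_sub hout.1 hball,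
      by simpa using hin.2.1, by simpa using hout.2.1⟩
  · refine ⟨fun ω hω => DifferentiableAt.differentiableWithinAt ?_,
      fun ω hω => DifferentiableAt.differentiableWithinAt ?_⟩
    · exact DifferentiableAt.comp ω (hFs _ (hball r hr) _ fun n hn =>
        (natCast_add_ne_zero_of_mem_calU hκ0.ne' hω hn).1)
        (by fun_prop : DifferentiableAt ℂ (fun ω => -(Complex.I * ω) / (2 * (κ : ℂ))) ω)
    · exact DifferentiableAt.comp ω (hFs _ (hball r hr) _ fun n hn =>
        (natCast_add_ne_zero_of_mem_calU hκ0.ne' hω hn).2)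
        (by fun_prop : DifferentiableAt ℂ (fun ω => Complex.I * ω / (2 * (κ : ℂ))) ω)
  · constructor
    · refine hsol ω _ (fun n hn => (natCast_add_ne_zero_of_mem_calU hκ0.ne' hω hn).1) ?_
      field_simp
      linear_combination 4 * ω ^ 2 * Complex.I_sq
    · refine hsol ω _ (fun n hn => (natCast_add_ne_zero_of_mem_calU hκ0.ne' hω hn).2) ?_
      field_simp
      linear_combination 4 * ω ^ 2 * Complex.I_sq
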